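/- Let G be a finite simple graph with mad(G) < 3 and ch_3^d(G) > 8 such that every proper subgraph H of G (obtained from G by deleting at least one vertex or at least one edge) satisfies ch_3^d(H) ≤ 8. Then for each k ∈ {4, 5}, every vertex of G of degree k has at most k − 2 neighbors of degree 2. -/

import Mathlib

open SimpleGraph

/-- `φ` is a proper coloring of `G` that is 3-dynamic: every vertex `v` sees at least
`min 3 (deg v)` distinct colors on its neighborhood. -/
def IsDyn3Coloring {V : Type*} (G : SimpleGraph V) (φ : V → ℕ) : Prop :=
  (∀ u v, G.Adj u v → φ u ≠ φ v) ∧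
  ∀ v, min 3 (G.neighborSet v).ncard ≤ (φ '' G.neighborSet v).ncard

/-- `G` is 3-dynamically colorable from the list assignment `L`. -/
def Dyn3ListColorable {V : Type*} (G : SimpleGraph V) (L : V → Finset ℕ) : Prop :=
  ∃ φ : V → ℕ, IsDyn3Coloring G φ ∧ ∀ v, φ v ∈ L v

/-- `ch_3^d(G) ≤ k` : `G` is 3-dynamically `L`-colorable for every list assignment `L`
with `|L v| ≥ k` for all `v`. -/
def Ch3dLE {V : Type*} (G : SimpleGraph V) (k : ℕ) : Prop :=
  ∀ L : V → Finset ℕ, (∀ v, k ≤ (L v).card) → Dyn3ListColorable G L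

/-- `mad(G) < c` : every nonempty subgraph has average degree `< c`. -/
def MadLT {V : Type*} (G : SimpleGraph V) (c : ℚ) : Prop :=
  ∀ H : G.Subgraph, H.verts.Nonempty →
    (2 * H.edgeSet.ncard : ℚ) / (H.verts.ncard : ℚ) < c

/-- `mad(G) ≤ c` : every nonempty subgraph has average degree `≤ c`. -/
def MadLE {V : Type*} (G : SimpleGraph V) (c : ℚ) : Prop :=
  ∀ H : G.Subgraph, H.verts.Nonempty →
    (2 * H.edgeSet.ncard : ℚ) / (H.verts.ncard : ℚ) ≤ c

/-- Every proper subgraph of `G` (deleting at least one vertex or edge) has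
`ch_3^d ≤ k`. -/
def ProperSubgraphsCh3dLE {V : Type*} (G : SimpleGraph V) (k : ℕ) : Prop :=
  ∀ H : G.Subgraph, H ≠ ⊤ → Ch3dLE H.coe k

/-- `x ∈ W_i(G)` : `x` has degree 3 and exactly `i` neighbors of degree 2. -/
def Wmem {V : Type*} (G : SimpleGraph V) (i : ℕ) (x : V) : Prop :=
  (G.neighborSet x).ncard = 3 ∧
    {y | G.Adj x y ∧ (G.neighborSet y).ncard = 2}.ncard = i

/-- `y` is a weak neighbor of `x` : they are distinct and have a common neighbor of
degree 2. -/
def WeakAdj {V : Type*} (G : SimpleGraph V) (x y : V) : Prop :=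
  x ≠ y ∧ ∃ w, G.Adj x w ∧ G.Adj y w ∧ (G.neighborSet w).ncard = 2

open Classical in
/-- partial 3-dynamic coloring on `S` -/
def GoodOn {V : Type*} [Fintype V] (G : SimpleGraph V) (S : Finset V) (φ : V → ℕ) : Prop :=
  (∀ u ∈ S, ∀ v ∈ S, G.Adj u v → φ u ≠ φ v) ∧
  ∀ x, min 3 (G.neighborFinset x ∩ S).card ≤ ((G.neighborFinset x ∩ S).image φ).card

open Classical in
/-- colors forbidden for a new vertex by its neighbor `x` -/
noncomputable def forb {V : Type*} [Fintype V] (G : SimpleGraph V) (S : Finset V) (φ : V → ℕ)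
    (x : V) : Finset ℕ :=
  (if x ∈ S then {φ x} else ∅) ∪
  (if ((G.neighborFinset x ∩ S).image φ).card ≤ 2 then (G.neighborFinset x ∩ S).image φ else ∅)

open Classical in
lemma forb_card_le {V : Type*} [Fintype V] (G : SimpleGraph V) (S : Finset V) (φ : V → ℕ)
    (x : V) : (forb G S φ x).card ≤ 3 := by
  unfold forb
  refine (Finset.card_union_le _ _).trans ?_
  split_ifs <;> simp <;> omega

open Classical in
lemma forb_card_le_one {V : Type*} [Fintype V] (G : SimpleGraph V) (S : Finset V) (φ : V → ℕ)
    (x : V) (hx : x ∉ S) (h1 : (G.neighborFinset x ∩ S).card ≤ 1) :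
    (forb G S φ x).card ≤ 1 := by
  unfold forb
  refine (Finset.card_union_le _ _).trans ?_
  have := Finset.card_image_le (s := G.neighborFinset x ∩ S) (f := φ)
  rw [if_neg hx]
  split_ifs <;> simp <;> omega

open Classical in
lemma extend_one {V : Type*} [Fintype V] (G : SimpleGraph V) (L : V → Finset ℕ)
    (hL : ∀ v, 8 ≤ (L v).card) (S : Finset V) (φ : V → ℕ) (hg : GoodOn G S φ)
    (hφ : ∀ x ∈ S, φ x ∈ L x) (y : V) (hy : y ∉ S)
    (hs : ∑ x ∈ G.neighborFinset y, (forb G S φ x).card < 8) :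
    ∃ φ' : V → ℕ, GoodOn G (insert y S) φ' ∧ ∀ x ∈ insert y S, φ' x ∈ L x := by
  have hc : ((G.neighborFinset y).biUnion (forb G S φ)).card < (L y).card :=
    (Finset.card_biUnion_le.trans_lt hs).trans_le (hL y)
  obtain ⟨c, hcL, hcF⟩ := Finset.exists_mem_notMem_of_card_lt_card hc
  have hF : ∀ x, G.Adj y x → c ∉ forb G S φ x := by
    intro x hx h
    exact hcF (Finset.mem_biUnion.2 ⟨x, by simpa using hx, h⟩)
  have hF1 : ∀ x ∈ S, G.Adj y x → c ≠ φ x := by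
    intro x hxS hx h
    apply hF x hx
    simp [forb, hxS, h]
  have hne : ∀ x ∈ S, x ≠ y := fun x hx h => hy (h ▸ hx)
  refine ⟨Function.update φ y c, ⟨?_, ?_⟩, ?_⟩
  · intro u hu v hv huv
    rw [Finset.mem_insert] at hu hv
    rcases hu with rfl | hu <;> rcases hv with rfl | hv
    · exact absurd huv (G.loopless.irrefl _)
    · rw [Function.update_self, Function.update_of_ne (hne v hv)]
      exact hF1 v hv huv
    · rw [Function.update_self, Function.update_of_ne (hne u hu)]
      exact (hF1 u hu huv.symm).symm
    · rw [Function.update_of_ne (hne u hu), Function.update_of_ne (hne v hv)]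
      exact hg.1 u hu v hv huv
  · intro x
    have himg : (G.neighborFinset x ∩ S).image (Function.update φ y c)
        = (G.neighborFinset x ∩ S).image φ := by
      apply Finset.image_congr
      intro z hz
      exact Function.update_of_ne (hne z (Finset.mem_inter.1 hz).2) _ _
    have h0 := hg.2 x
    by_cases hxy : G.Adj y x
    · have hm : y ∈ G.neighborFinset x := by simpa using hxy.symm
      rw [Finset.inter_insert_of_mem hm, Finset.image_insert, himg, Function.update_self,
        Finset.card_insert_of_notMem (by simp [hy])]
      by_cases h2 : ((G.neighborFinset x ∩ S).image φ).card ≤ 2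
      · have hn : c ∉ (G.neighborFinset x ∩ S).image φ := by
          intro h
          apply hF x hxy
          unfold forb
          rw [if_pos h2]
          exact Finset.mem_union_right _ h
        rw [Finset.card_insert_of_notMem hn]
        omega
      · have := Finset.card_le_card (Finset.subset_insert c ((G.neighborFinset x ∩ S).image φ))
        omega
    · have hm : y ∉ G.neighborFinset x := by simpa using fun h => hxy (SimpleGraph.Adj.symm h)
      rw [Finset.inter_insert_of_notMem hm, himg]
      exact h0
  · intro x hx
    rw [Finset.mem_insert] at hx
    rcases hx with rfl | hx
    · rwa [Function.update_self]
    · rw [Function.update_of_ne (hne x hx)]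
      exact hφ x hx

open Classical in
lemma extend_all {V : Type*} [Fintype V] (G : SimpleGraph V) (L : V → Finset ℕ)
    (hL : ∀ v, 8 ≤ (L v).card) (n : ℕ) : ∀ (S : Finset V) (φ : V → ℕ), GoodOn G S φ →
    (∀ x ∈ S, φ x ∈ L x) → (∀ x ∉ S, (G.neighborFinset x).card ≤ 2) → Sᶜ.card = n →
    ∃ φ' : V → ℕ, GoodOn G Finset.univ φ' ∧ ∀ x, φ' x ∈ L x := by
  induction n with
  | zero =>
    intro S φ hg hφ _ hn
    have : S = Finset.univ := by simpa using hn
    subst this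
    exact ⟨φ, hg, fun x => hφ x (Finset.mem_univ x)⟩
  | succ n ih =>
    intro S φ hg hφ hd hn
    have hne : Sᶜ.Nonempty := by rw [← Finset.card_pos]; omega
    obtain ⟨y, hy⟩ := hne
    have hyS : y ∉ S := by simpa using hy
    obtain ⟨φ', hg', hφ'⟩ := extend_one G L hL S φ hg hφ y hyS (by
      have := Finset.sum_le_card_nsmul (G.neighborFinset y) (fun x => (forb G S φ x).card) 3
        (fun x _ => forb_card_le G S φ x)
      have h2 := hd y hyS
      simp only [smul_eq_mul] at this
      omega)
    refine ih (insert y S) φ' hg' hφ' (fun x hx => hd x (fun h => hx (Finset.mem_insert_of_mem h))) ?_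
    rw [Finset.compl_insert, Finset.card_erase_of_mem hy, hn]
    rfl

open Classical in
lemma ncard_nb {V : Type*} [Fintype V] (G : SimpleGraph V) (x : V) :
    (G.neighborSet x).ncard = (G.neighborFinset x).card := by
  rw [← Set.ncard_coe_finset, SimpleGraph.coe_neighborFinset]

open Classical in
lemma good_base {V : Type*} [Fintype V] (G : SimpleGraph V) (hmin : ProperSubgraphsCh3dLE G 8)
    (L : V → Finset ℕ) (hL : ∀ v, 8 ≤ (L v).card) (S : Finset V) (v : V) (hv : v ∉ S)
    (h1 : ∀ x ∉ S, (G.neighborFinset x ∩ S).card ≤ 1) :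
    ∃ φ : V → ℕ, GoodOn G S φ ∧ ∀ x ∈ S, φ x ∈ L x := by
  let H : G.Subgraph := (⊤ : G.Subgraph).induce (S : Set V)
  have hH : H ≠ ⊤ := by
    intro h
    have : v ∈ H.verts := by rw [h]; trivial
    exact hv this
  obtain ⟨ψ, ⟨hp, hd⟩, hψL⟩ := hmin H hH (fun x => L x.1) (fun x => hL x.1)
  let φ : V → ℕ := fun x => if h : x ∈ S then ψ ⟨x, h⟩ else 0
  have hφ : ∀ x (h : x ∈ S), φ x = ψ ⟨x, h⟩ := fun x h => dif_pos h
  refine ⟨φ, ⟨?_, ?_⟩, ?_⟩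
  · intro u hu w hw huw
    rw [hφ u hu, hφ w hw]
    apply hp
    simp [H, hu, hw, huw]
  · intro x
    by_cases hx : x ∈ S
    · have key := hd ⟨x, hx⟩
      have e1 : ((G.neighborFinset x ∩ S : Finset V) : Set V)
          = Subtype.val '' (H.coe.neighborSet ⟨x, hx⟩) := by
        ext z
        simp [H, hx]
        tauto
      have e2 : (((G.neighborFinset x ∩ S).image φ : Finset ℕ) : Set ℕ)
          = ψ '' (H.coe.neighborSet ⟨x, hx⟩) := by
        rw [Finset.coe_image, e1, Set.image_image]
        apply Set.image_congr
        intro z _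
        exact hφ z.1 z.2
      rw [← Set.ncard_coe_finset, ← Set.ncard_coe_finset, e2, e1,
        Set.ncard_image_of_injective _ Subtype.val_injective]
      exact key
    · have := h1 x hx
      rcases Nat.lt_or_ge 0 (G.neighborFinset x ∩ S).card with h | h
      · have h3 : 0 < ((G.neighborFinset x ∩ S).image φ).card := by
          rw [Finset.card_pos] at h ⊢
          exact h.image φ
        omega
      · omega
  · intro x hx
    rw [hφ x hx]
    exact hψL ⟨x, hx⟩

theorem min_counterexample8_few_two_neighbors {V : Type*} [Fintype V]
    (G : SimpleGraph V) (hmad : MadLT G 3) (hG : ¬ Ch3dLE G 8)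
    (hmin : ProperSubgraphsCh3dLE G 8) :
    ∀ k ∈ ({4, 5} : Set ℕ), ∀ v : V, (G.neighborSet v).ncard = k →
      {y | G.Adj v y ∧ (G.neighborSet y).ncard = 2}.ncard ≤ k - 2 := by
  classical
  intro k hk v hv
  have hk' : k = 4 ∨ k = 5 := by simpa using hk
  by_contra hcon
  apply hG
  intro L hL
  let T : Finset V := (G.neighborFinset v).filter (fun y => (G.neighborFinset y).card = 2)
  have hT : {y | G.Adj v y ∧ (G.neighborSet y).ncard = 2} = (T : Set V) := by
    ext y
    simp only [ncard_nb, T, Finset.coe_filter, SimpleGraph.mem_neighborFinset]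
  rw [hT, Set.ncard_coe_finset] at hcon
  rw [ncard_nb] at hv
  have hTN : T ⊆ G.neighborFinset v := Finset.filter_subset _ _
  have hvT : v ∉ T := fun h => by simpa using hTN h
  have hdiff : (G.neighborFinset v \ T).card = k - T.card := by
    rw [Finset.card_sdiff_of_subset hTN, hv]
  let S : Finset V := (insert v T)ᶜ
  have hvS : v ∉ S := by simp [S]
  have hTS : ∀ x ∈ T, x ∉ S := by intro x hx; simp [S, hx]
  have hTcard : T.card ≤ k := hv ▸ Finset.card_le_card hTN
  have hN1 : ∀ x ∈ T, (G.neighborFinset x ∩ S).card ≤ 1 := by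
    intro x hx
    have hx' := Finset.mem_filter.1 hx
    have hvx : v ∈ G.neighborFinset x := by
      have := hx'.1
      simp only [SimpleGraph.mem_neighborFinset] at this ⊢
      exact this.symm
    have : G.neighborFinset x ∩ S ⊆ (G.neighborFinset x).erase v := by
      intro z hz
      rw [Finset.mem_inter] at hz
      exact Finset.mem_erase.2 ⟨fun h => hvS (h ▸ hz.2), hz.1⟩
    have := Finset.card_le_card this
    rw [Finset.card_erase_of_mem hvx] at this
    omega
  have h1 : ∀ x ∉ S, (G.neighborFinset x ∩ S).card ≤ 1 := by
    intro x hx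
    have hx' : x = v ∨ x ∈ T := by
      simp only [S, Finset.mem_insert, Finset.mem_compl] at hx
      tauto
    rcases hx' with rfl | hx'
    · have : G.neighborFinset x ∩ S ⊆ G.neighborFinset x \ T := by
        intro z hz
        rw [Finset.mem_inter] at hz
        exact Finset.mem_sdiff.2 ⟨hz.1, fun h => hTS z h hz.2⟩
      have := Finset.card_le_card this
      omega
    · exact hN1 x hx'
  obtain ⟨φ, hg, hφ⟩ := good_base G hmin L hL S v hvS h1
  obtain ⟨φ', hg', hφ'⟩ := extend_one G L hL S φ hg hφ v hvS (by
    rw [← Finset.sum_sdiff hTN]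
    have a := Finset.sum_le_card_nsmul (G.neighborFinset v \ T)
      (fun x => (forb G S φ x).card) 3 (fun x _ => forb_card_le G S φ x)
    have b := Finset.sum_le_card_nsmul T
      (fun x => (forb G S φ x).card) 1 
      (fun x hx => forb_card_le_one G S φ x (hTS x hx) (hN1 x hx))
    simp only [smul_eq_mul] at a b
    omega)
  obtain ⟨φ'', hg'', hφ''⟩ := extend_all G L hL _ (insert v S) φ' hg' hφ' (by
    intro x hx
    have : x ∈ T := by
      simp only [S, Finset.mem_insert, Finset.mem_compl, not_or, not_not] at hx
      tauto
    exact (Finset.mem_filter.1 this).2.le) rfl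
  refine ⟨φ'', ⟨fun u w h => hg''.1 u (Finset.mem_univ _) w (Finset.mem_univ _) h, ?_⟩, hφ''⟩
  intro x
  have := hg''.2 x
  rw [Finset.inter_univ] at this
  rw [← Set.ncard_coe_finset (Finset.image _ _), Finset.coe_image, SimpleGraph.coe_neighborFinset] at this
  rw [ncard_nb]
  exact this
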